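/- Let d ≥ 1 and let a = (a_{αγ}), b = (b_{αβ}), c = (c_{βδ}) be d×d complex matrices with b invertible. Set Z := (1/2)·a_{αγ}θ^αθ^γ + b_{αβ}θ^αθ̄^β + (1/2)·c_{βδ}θ̄^βθ̄^δ ∈ Λ_d and write e^Z = w_{IJ}θ^Iθ̄^J with w_{IJ} ∈ ℂ. Let (t^{JI}) be the inverse of the 2^d×2^d matrix (w_{IJ}), with the convention t^{LK}w_{KJ} = δ^L_J and w_{IK}t^{KJ} = δ_I^J. Then the entry t^{[d][d]} (with both indices the full set [d]) equals (−1)^{d(d−1)/2}·(det b)^{−1}. -/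

import Mathlib

noncomputable section
open scoped BigOperators

namespace Grass

/-- Index sets for Grassmann monomials: subsets of `[d] = {1,…,d}` (0-based in Lean). -/
abbrev Ix (d : ℕ) := Finset (Fin d)

/-- Coefficient representation of the Grassmann algebra `Λ_d` on the `2d` generators
`θ^1,…,θ^d, θ̄^1,…,θ̄^d`: an element is the family of its coefficients in the
basis `θ^I θ̄^J`, `I, J ⊆ [d]`. -/
abbrev Gr (d : ℕ) := Ix d → Ix d → ℂ

/-- The sign `(±1)` obtained when reordering `θ^I · θ^K` (with `I, K` disjoint) into the
increasing monomial `θ^{I ∪ K}`: one transposition for each pair `i ∈ I, k ∈ K` with `k < i`. -/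
def rsign {d : ℕ} (I K : Ix d) : ℤ := (-1 : ℤ) ^ (∑ i ∈ I, (K.filter (fun k => k < i)).card)

/-- The (associative) multiplication of the Grassmann algebra `Λ_d` in the coefficient
representation: determined by `θ^I θ̄^J · θ^K θ̄^L = (-1)^{|J||K|} rsign(I,K) rsign(J,L)
θ^{I∪K} θ̄^{J∪L}` for disjoint `I,K` and disjoint `J,L`, and `0` otherwise. -/
def gmul {d : ℕ} (f g : Gr d) : Gr d := fun K L =>
  ∑ I ∈ K.powerset, ∑ J ∈ L.powerset,
    (((-1 : ℤ) ^ (J.card * (K \ I).card) * rsign I (K \ I) * rsign J (L \ J) : ℤ) : ℂ) *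
      (f I J * g (K \ I) (L \ J))

/-- The identity `1 = θ^∅ θ̄^∅` of `Λ_d`. -/
def gone (d : ℕ) : Gr d := fun K L => if K = ∅ ∧ L = ∅ then 1 else 0

/-- Powers in `Λ_d`. -/
def gpow {d : ℕ} (f : Gr d) : ℕ → Gr d
  | 0 => gone d
  | n + 1 => gmul (gpow f n) f

/-- The exponential `e^f = Σ_{n≥0} f^n/n!` of a nilpotent element of `Λ_d`
(all powers `f^n` with `n > 2d` of an element with no `θ^∅θ̄^∅`-component vanish,
so the series is the indicated finite sum). -/
def gexp {d : ℕ} (f : Gr d) : Gr d :=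
  ∑ n ∈ Finset.range (2 * d + 1), ((n.factorial : ℂ)⁻¹) • gpow f n

/-- The generator `θ^α`. -/
def θ {d : ℕ} (α : Fin d) : Gr d := fun K L => if K = {α} ∧ L = ∅ then 1 else 0

/-- The generator `θ̄^β`. -/
def θb {d : ℕ} (β : Fin d) : Gr d := fun K L => if K = ∅ ∧ L = {β} then 1 else 0

/-- The monomial `θ^I`. -/
def θmon {d : ℕ} (I : Ix d) : Gr d := fun K L => if K = I ∧ L = ∅ then 1 else 0

/-- The quadratic element
`Z = (1/2)a_{αγ}θ^αθ^γ + b_{αβ}θ^αθ̄^β + (1/2)c_{βδ}θ̄^βθ̄^δ` of `Λ_d`. -/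
def quadZ {d : ℕ} (a b c : Matrix (Fin d) (Fin d) ℂ) : Gr d :=
  (1 / 2 : ℂ) • (∑ α, ∑ γ, a α γ • gmul (θ α) (θ γ))
    + (∑ α, ∑ β, b α β • gmul (θ α) (θb β))
    + (1 / 2 : ℂ) • (∑ β, ∑ δ, c β δ • gmul (θb β) (θb δ))

/-- `ε(I) = α_1 + ⋯ + α_k − k(k+1)/2` for `I = {α_1 < … < α_k} ⊆ [d]`
(`1`-based values, so `α+1` for `α : Fin d`). -/
def epsZ {d : ℕ} (I : Ix d) : ℤ :=
  (∑ α ∈ I, ((α : ℤ) + 1)) - (I.card * (I.card + 1)) / 2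


section MyProof
open Finset

def GA (d : ℕ) := Gr d

variable {d : ℕ}

instance : AddCommGroup (GA d) := inferInstanceAs (AddCommGroup (Ix d → Ix d → ℂ))
instance : Module ℂ (GA d) := inferInstanceAs (Module ℂ (Ix d → Ix d → ℂ))
instance : Module ℚ (GA d) := inferInstanceAs (Module ℚ (Ix d → Ix d → ℂ))

def sg (I J K L : Ix d) : ℂ :=
  (((-1 : ℤ) ^ (J.card * K.card) * rsign I K * rsign J L : ℤ) : ℂ)

def mon (I J : Ix d) : GA d := fun K L => if K = I ∧ L = J then 1 else 0

def gmulL : GA d →ₗ[ℂ] GA d →ₗ[ℂ] GA d :=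
  LinearMap.mk₂ ℂ (fun f g => (gmul f g : Gr d))
    (by intro f f' g; funext K L
        show gmul (fun I J => f I J + f' I J) g K L = gmul f g K L + gmul f' g K L
        simp only [gmul, ← sum_add_distrib]
        refine sum_congr rfl fun _ _ => sum_congr rfl fun _ _ => by ring)
    (by intro c f g; funext K L
        show gmul (fun I J => c * f I J) g K L = c * gmul f g K L
        simp only [gmul, mul_sum]
        refine sum_congr rfl fun _ _ => sum_congr rfl fun _ _ => by ring)
    (by intro f g g'; funext K L
        show gmul f (fun I J => g I J + g' I J) K L = gmul f g K L + gmul f g' K L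
        simp only [gmul, ← sum_add_distrib]
        refine sum_congr rfl fun _ _ => sum_congr rfl fun _ _ => by ring)
    (by intro c f g; funext K L
        show gmul f (fun I J => c * g I J) K L = c * gmul f g K L
        simp only [gmul, mul_sum]
        refine sum_congr rfl fun _ _ => sum_congr rfl fun _ _ => by ring)

lemma gmulL_apply (f g : GA d) (K L : Ix d) : gmulL f g K L =
    ∑ I ∈ K.powerset, ∑ J ∈ L.powerset,
    sg I J (K \ I) (L \ J) * (f I J * g (K \ I) (L \ J)) := rfl

def coef (K L : Ix d) : GA d →ₗ[ℂ] ℂ where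
  toFun f := f K L
  map_add' _ _ := rfl
  map_smul' _ _ := rfl

lemma GA.sum_apply {ι : Type*} (s : Finset ι) (f : ι → GA d) (K L : Ix d) :
    (∑ i ∈ s, f i) K L = ∑ i ∈ s, f i K L := map_sum (coef K L) f s

lemma GA.smul_apply (c : ℂ) (f : GA d) (K L : Ix d) : (c • f) K L = c * f K L := rfl
lemma GA.add_apply (f g : GA d) (K L : Ix d) : (f + g) K L = f K L + g K L := rfl
lemma GA.zero_apply (K L : Ix d) : (0 : GA d) K L = 0 := rfl

lemma GA.eq_sum (f : GA d) : f = ∑ I, ∑ J, f I J • mon I J := by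
  funext K L
  rw [GA.sum_apply, Finset.sum_eq_single K, GA.sum_apply, Finset.sum_eq_single L]
  · simp [GA.smul_apply, mon]
  · intro b _ hb; simp [GA.smul_apply, mon, hb.symm]
  · simp
  · intro b _ hb; rw [GA.sum_apply]; simp [GA.smul_apply, mon, hb.symm]
  · simp

lemma mon_mul (I J I' J' : Ix d) : gmulL (mon I J) (mon I' J') =
    if Disjoint I I' ∧ Disjoint J J' then sg I J I' J' • mon (I ∪ I') (J ∪ J') else 0 := by
  funext K L
  rw [gmulL_apply]
  by_cases h : I ⊆ K ∧ J ⊆ L ∧ K \ I = I' ∧ L \ J = J'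
  · obtain ⟨h1, h2, rfl, rfl⟩ := h
    rw [Finset.sum_eq_single I, Finset.sum_eq_single J, if_pos ⟨disjoint_sdiff, disjoint_sdiff⟩,
      union_sdiff_of_subset h1, union_sdiff_of_subset h2]
    · simp [mon, GA.smul_apply]
    · intro b _ hb; simp [mon, hb]
    · simp [h2]
    · intro b _ hb; simp [mon, hb]
    · simp [h1]
  · rw [Finset.sum_eq_zero]
    · split_ifs with h'
      · rw [GA.smul_apply, mon, if_neg, mul_zero]
        rintro ⟨rfl, rfl⟩
        apply h
        refine ⟨subset_union_left, subset_union_left, ?_, ?_⟩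
        · rw [union_sdiff_cancel_left h'.1]
        · rw [union_sdiff_cancel_left h'.2]
      · rfl
    · intro A hA
      apply Finset.sum_eq_zero
      intro B hB
      simp only [mem_powerset] at hA hB
      by_cases h1 : A = I ∧ B = J
      · obtain ⟨rfl, rfl⟩ := h1
        have : ¬ (K \ A = I' ∧ L \ B = J') := fun h2 => h ⟨hA, hB, h2⟩
        simp [mon, this]
      · simp [mon, h1]

lemma rsign_union_left {I I' K : Ix d} (h : Disjoint I I') :
    rsign (I ∪ I') K = rsign I K * rsign I' K := by
  simp [rsign, sum_union h, pow_add]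

lemma rsign_union_right {I K K' : Ix d} (h : Disjoint K K') :
    rsign I (K ∪ K') = rsign I K * rsign I K' := by
  simp only [rsign, ← pow_add, ← sum_add_distrib]
  congr 1
  refine sum_congr rfl fun i _ => ?_
  rw [filter_union, card_union_of_disjoint (disjoint_filter_filter h)]

lemma sg_union_left {I J I' J' K L : Ix d} (h : Disjoint I I') (h' : Disjoint J J') :
    sg (I ∪ I') (J ∪ J') K L = sg I J K L * sg I' J' K L := by
  simp only [sg, rsign_union_left h, rsign_union_left h', card_union_of_disjoint h', add_mul,
    pow_add]
  push_cast; ring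

lemma sg_union_right {I J K L K' L' : Ix d} (h : Disjoint K K') (h' : Disjoint L L') :
    sg I J (K ∪ K') (L ∪ L') = sg I J K L * sg I J K' L' := by
  simp only [sg, rsign_union_right h, rsign_union_right h', card_union_of_disjoint h, mul_add,
    pow_add]
  push_cast; ring

lemma mon_assoc (I J I' J' K L : Ix d) : gmulL (gmulL (mon I J) (mon I' J')) (mon K L) =
    gmulL (mon I J) (gmulL (mon I' J') (mon K L)) := by
  by_cases h1 : Disjoint I I' ∧ Disjoint J J'
  · by_cases h2 : Disjoint I' K ∧ Disjoint J' L
    · by_cases h3 : Disjoint I K ∧ Disjoint J L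
      · rw [mon_mul, mon_mul I', if_pos h1, if_pos h2, map_smul, LinearMap.smul_apply, map_smul,
          mon_mul, mon_mul, if_pos, if_pos, smul_smul, smul_smul, sg_union_left h1.1 h1.2,
          sg_union_right h2.1 h2.2, union_assoc, union_assoc]
        · congr 1; ring
        · simp [disjoint_union_right, *]
        · simp [disjoint_union_left, *]
      · rw [mon_mul, mon_mul I', if_pos h1, if_pos h2, map_smul, LinearMap.smul_apply, map_smul,
          mon_mul, mon_mul, if_neg, if_neg]
        · simp
        · simp only [disjoint_union_left, disjoint_union_right]; tauto
        · simp only [disjoint_union_left, disjoint_union_right]; tauto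
    · rw [mon_mul, mon_mul I', if_pos h1, if_neg h2, map_smul, LinearMap.smul_apply, map_zero,
          mon_mul, if_neg]
      · simp
      · simp only [disjoint_union_left]; tauto
  · rw [mon_mul, if_neg h1, map_zero, LinearMap.zero_apply, mon_mul I']
    split_ifs with h2
    · rw [map_smul, mon_mul, if_neg]
      · simp
      · simp only [disjoint_union_right]; tauto
    · simp

lemma gmulL_assoc (f g h : GA d) : gmulL (gmulL f g) h = gmulL f (gmulL g h) := by
  rw [GA.eq_sum f, GA.eq_sum g, GA.eq_sum h]
  simp only [map_sum, map_smul, LinearMap.sum_apply, LinearMap.smul_apply, smul_sum, mon_assoc]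

lemma sg_empty_left (K L : Ix d) : sg ∅ ∅ K L = 1 := by simp [sg, rsign]
lemma sg_empty_right (K L : Ix d) : sg K L ∅ ∅ = 1 := by simp [sg, rsign]

lemma gmulL_one_left (f : GA d) : gmulL (mon ∅ ∅) f = f := by
  conv_rhs => rw [GA.eq_sum f]
  conv_lhs => rw [GA.eq_sum f]
  simp [mon_mul, sg_empty_left]

lemma gmulL_one_right (f : GA d) : gmulL f (mon ∅ ∅) = f := by
  conv_rhs => rw [GA.eq_sum f]
  conv_lhs => rw [GA.eq_sum f]
  simp [mon_mul, sg_empty_right, LinearMap.sum_apply]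

instance : Ring (GA d) where
  __ := (inferInstance : AddCommGroup (GA d))
  mul f g := gmulL f g
  one := mon ∅ ∅
  mul_assoc := gmulL_assoc
  one_mul := gmulL_one_left
  mul_one := gmulL_one_right
  zero_mul f := by show gmulL 0 f = 0; simp
  mul_zero f := by show gmulL f 0 = 0; simp
  left_distrib f g h := by show gmulL f (g + h) = gmulL f g + gmulL f h; simp
  right_distrib f g h := by show gmulL (f + g) h = gmulL f h + gmulL g h; simp

lemma GA.mul_def (f g : GA d) : f * g = gmulL f g := rfl
lemma GA.one_def : (1 : GA d) = mon ∅ ∅ := rfl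

instance : Algebra ℂ (GA d) := Algebra.ofModule
  (fun r x y => by simp [GA.mul_def]) (fun r x y => by simp [GA.mul_def])

instance : IsScalarTower ℚ ℂ (GA d) := inferInstanceAs (IsScalarTower ℚ ℂ (Ix d → Ix d → ℂ))
instance : Algebra ℚ (GA d) := Algebra.ofModule
  (fun r x y => by
    rw [← algebraMap_smul ℂ r x, ← algebraMap_smul ℂ r (x * y)]; simp)
  (fun r x y => by
    rw [← algebraMap_smul ℂ r y, ← algebraMap_smul ℂ r (x * y)]; simp)

lemma gpow_eq (f : GA d) (n : ℕ) : (gpow f n : Gr d) = (f ^ n : GA d) := by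
  induction n with
  | zero => rfl
  | succ n ih => rw [pow_succ]; show gmul (gpow f n) f = _; rw [ih]; rfl


lemma GA.qsmul_apply (c : ℚ) (f : GA d) (K L : Ix d) : (c • f) K L = (c : ℂ) * f K L := by
  show c • (f K L) = _
  rw [Rat.smul_def]

def Supp (p : Ix d → Ix d → Prop) (f : GA d) : Prop := ∀ I J, f I J ≠ 0 → p I J

lemma Supp.mono {p q : Ix d → Ix d → Prop} {f : GA d} (hf : Supp p f)
    (h : ∀ I J, p I J → q I J) : Supp q f := fun I J hIJ => h I J (hf I J hIJ)

lemma Supp.add {p : Ix d → Ix d → Prop} {f g : GA d} (hf : Supp p f) (hg : Supp p g) :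
    Supp p (f + g) := by
  intro I J h
  by_cases h1 : f I J = 0
  · refine hg I J fun h2 => h ?_
    rw [GA.add_apply, h1, h2, add_zero]
  · exact hf I J h1

lemma Supp.zero {p : Ix d → Ix d → Prop} : Supp p (0 : GA d) := fun _ _ h => absurd rfl h

lemma Supp.smul {p : Ix d → Ix d → Prop} {f : GA d} (c : ℂ) (hf : Supp p f) :
    Supp p (c • f) := by
  intro I J h
  exact hf I J fun h2 => h (by rw [GA.smul_apply, h2, mul_zero])

lemma Supp.qsmul {p : Ix d → Ix d → Prop} {f : GA d} (c : ℚ) (hf : Supp p f) :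
    Supp p (c • f) := by
  intro I J h
  exact hf I J fun h2 => h (by rw [GA.qsmul_apply, h2, mul_zero])

lemma Supp.sum {ι : Type*} {p : Ix d → Ix d → Prop} {s : Finset ι} {f : ι → GA d}
    (hf : ∀ i ∈ s, Supp p (f i)) : Supp p (∑ i ∈ s, f i) :=
  Finset.sum_induction f (Supp p) (fun _ _ => Supp.add) Supp.zero hf

lemma Supp.mul {p q r : Ix d → Ix d → Prop} {f g : GA d} (hf : Supp p f) (hg : Supp q g)
    (h : ∀ I J K L, Disjoint I K → Disjoint J L → p I J → q K L → r (I ∪ K) (J ∪ L)) :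
    Supp r (f * g) := by
  intro K L hKL
  rw [GA.mul_def, gmulL_apply] at hKL
  obtain ⟨I, hI, h1⟩ := Finset.exists_ne_zero_of_sum_ne_zero hKL
  obtain ⟨J, hJ, h2⟩ := Finset.exists_ne_zero_of_sum_ne_zero h1
  have h3 := right_ne_zero_of_mul h2
  rw [mem_powerset] at hI hJ
  have := h I J (K \ I) (L \ J) disjoint_sdiff disjoint_sdiff
    (hf _ _ (left_ne_zero_of_mul h3)) (hg _ _ (right_ne_zero_of_mul h3))
  rwa [union_sdiff_of_subset hI, union_sdiff_of_subset hJ] at this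

lemma Supp.mon {p : Ix d → Ix d → Prop} {I J : Ix d} (h : p I J) : Supp p (mon I J) := by
  intro K L hKL
  by_cases h1 : K = I ∧ L = J
  · rw [h1.1, h1.2]; exact h
  · exact absurd (if_neg h1) hKL

lemma Supp.pow {p : Ix d → Ix d → Prop} {f : GA d} (hf : Supp p f) (h0 : p ∅ ∅)
    (h : ∀ I J K L, Disjoint I K → Disjoint J L → p I J → p K L → p (I ∪ K) (J ∪ L)) (n : ℕ) :
    Supp p (f ^ n) := by
  induction n with
  | zero => rw [pow_zero]; exact Supp.mon h0
  | succ n ih => rw [pow_succ]; exact ih.mul hf h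

/-- no constant term -/
abbrev Nil (f : GA d) : Prop := Supp (fun I J => 1 ≤ I.card + J.card) f

lemma Nil.pow {f : GA d} (hf : Nil f) (n : ℕ) : Supp (fun I J => n ≤ I.card + J.card) (f ^ n) := by
  induction n with
  | zero => intro _ _ _; exact Nat.zero_le _
  | succ n ih =>
    rw [pow_succ]
    refine ih.mul hf fun I J K L h1 h2 h3 h4 => ?_
    rw [card_union_of_disjoint h1, card_union_of_disjoint h2]
    omega

lemma Nil.pow_eq {f : GA d} (hf : Nil f) : f ^ (2 * d + 1) = 0 := by
  funext I J
  by_contra h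
  have := hf.pow _ I J h
  have h1 := card_le_univ I
  have h2 := card_le_univ J
  simp only [Fintype.card_fin] at h1 h2
  omega

lemma Nil.isNilpotent {f : GA d} (hf : Nil f) : IsNilpotent f := ⟨_, hf.pow_eq⟩

lemma Nil.gexp_eq {f : GA d} (hf : Nil f) : (gexp f : Gr d) = (IsNilpotent.exp f : GA d) := by
  rw [IsNilpotent.exp_eq_sum hf.pow_eq]
  funext I J
  rw [GA.sum_apply]
  simp only [gexp, Finset.sum_apply, GA.qsmul_apply]
  refine sum_congr rfl fun n _ => ?_
  rw [← gpow_eq]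
  simp

lemma Supp.exp {p : Ix d → Ix d → Prop} {f : GA d} (hf : Supp p f) (hn : Nil f) (h0 : p ∅ ∅)
    (h : ∀ I J K L, Disjoint I K → Disjoint J L → p I J → p K L → p (I ∪ K) (J ∪ L)) :
    Supp p (IsNilpotent.exp f) := by
  rw [IsNilpotent.exp_eq_sum hn.pow_eq]
  exact Supp.sum fun n _ => (hf.pow h0 h n).qsmul _

lemma mul_empty (f g : GA d) : (f * g) ∅ ∅ = f ∅ ∅ * g ∅ ∅ := by
  rw [GA.mul_def, gmulL_apply]
  simp [sg_empty_left]

def aug : GA d →+* ℂ where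
  toFun f := f ∅ ∅
  map_one' := by simp [GA.one_def, mon]
  map_mul' := mul_empty
  map_zero' := rfl
  map_add' _ _ := rfl

lemma exp_empty {f : GA d} (hf : Nil f) : (IsNilpotent.exp f : GA d) ∅ ∅ = 1 := by
  have h := IsNilpotent.map_exp hf.isNilpotent (aug (d := d))
  have h0 : aug f = 0 := by
    by_contra h0
    have := hf ∅ ∅ h0
    simp at this
  rw [h0, IsNilpotent.exp_zero] at h
  exact h

def T (α : Fin d) : GA d := mon {α} ∅
def Tb (β : Fin d) : GA d := mon ∅ {β}
def G (x : Fin d ⊕ Fin d) : GA d := Sum.elim T Tb x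

lemma TT (α γ : Fin d) : T α * T γ = -(T γ * T α) := by
  simp only [T, GA.mul_def, mon_mul]
  rcases lt_trichotomy α γ with h | rfl | h
  · simp [h.ne, h.ne', sg, rsign, h, filter_singleton, h.not_gt, union_comm]
  · simp
  · simp [h.ne, h.ne', sg, rsign, h, filter_singleton, h.not_gt, union_comm]

lemma TbTb (α γ : Fin d) : Tb α * Tb γ = -(Tb γ * Tb α) := by
  simp only [Tb, GA.mul_def, mon_mul]
  rcases lt_trichotomy α γ with h | rfl | h
  · simp [h.ne, h.ne', sg, rsign, h, filter_singleton, h.not_gt, union_comm]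
  · simp
  · simp [h.ne, h.ne', sg, rsign, h, filter_singleton, h.not_gt, union_comm]

lemma TbT (α γ : Fin d) : Tb α * T γ = -(T γ * Tb α) := by
  simp [Tb, T, GA.mul_def, mon_mul, sg, rsign]

lemma G_anti (x y : Fin d ⊕ Fin d) : G x * G y = -(G y * G x) := by
  rcases x with x | x <;> rcases y with y | y <;> simp only [G, Sum.elim_inl, Sum.elim_inr]
  · exact TT x y
  · rw [TbT, neg_neg]
  · exact TbT x y
  · exact TbTb x y

lemma G_comm (w x y z : Fin d ⊕ Fin d) : Commute (G w * G x) (G y * G z) := by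
  have key : ∀ u, Commute (G w * G x) (G u) := by
    intro u
    show G w * G x * G u = G u * (G w * G x)
    rw [mul_assoc, G_anti x u, mul_neg, ← mul_assoc, G_anti w u, neg_mul, neg_neg, mul_assoc]
  exact (key y).mul_right (key z)

def qd (m : Matrix (Fin d) (Fin d) ℂ) (f g : Fin d → Fin d ⊕ Fin d) : GA d :=
  ∑ α, ∑ γ, m α γ • (G (f α) * G (g γ))

lemma qd_comm (m n f g h k) : Commute (qd (d := d) m f g) (qd n h k) := by
  refine Commute.sum_left _ _ _ fun _ _ => Commute.sum_left _ _ _ fun _ _ =>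
    Commute.smul_left (Commute.sum_right _ _ _ fun _ _ => Commute.sum_right _ _ _ fun _ _ =>
    Commute.smul_right (G_comm _ _ _ _) _) _

lemma G_nil (x : Fin d ⊕ Fin d) : Nil (G x) := by
  rcases x with x | x
  · exact Supp.mon (by simp)
  · exact Supp.mon (by simp)

lemma Nil.mul' {f g : GA d} (hf : Nil f) (hg : Nil g) : Nil (f * g) :=
  Supp.mul hf hg fun I J K L h1 h2 h3 h4 => by
    rw [card_union_of_disjoint h1, card_union_of_disjoint h2]; omega

lemma qd_nil (m f g) : Nil (qd (d := d) m f g) :=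
  Supp.sum fun _ _ => Supp.sum fun _ _ => Supp.smul _ ((G_nil _).mul' (G_nil _))

lemma quadZ_eq (a b c : Matrix (Fin d) (Fin d) ℂ) : (quadZ a b c : Gr d) =
    ((1 / 2 : ℂ) • qd a Sum.inl Sum.inl + qd b Sum.inl Sum.inr
      + (1 / 2 : ℂ) • qd c Sum.inr Sum.inr : GA d) := rfl

/-- the linear map `v ↦ v_β θ̄^β` -/
def Th : (Fin d → ℂ) →ₗ[ℂ] GA d := Fintype.linearCombination ℂ Tb

lemma Th_apply (v : Fin d → ℂ) : Th v = ∑ β, v β • Tb β := rfl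

lemma Th_anti (u v : Fin d → ℂ) : Th u * Th v = -(Th v * Th u) := by
  simp only [Th_apply, sum_mul, mul_sum, smul_mul_assoc, mul_smul_comm, smul_sum]
  rw [sum_comm, ← sum_neg_distrib]
  refine sum_congr rfl fun x _ => ?_
  rw [← sum_neg_distrib]
  refine sum_congr rfl fun y _ => ?_
  rw [TbTb, smul_neg, smul_neg, smul_comm]

lemma Th_T (u : Fin d → ℂ) (α : Fin d) : Th u * T α = -(T α * Th u) := by
  simp only [Th_apply, sum_mul, mul_sum, smul_mul_assoc, mul_smul_comm, TbT, smul_neg,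
    sum_neg_distrib]

lemma self_zero {x : GA d} (h : x = -x) : x = 0 := by
  have h2 : (2 : ℂ) • x = 0 := by
    rw [two_smul]; nth_rewrite 2 [h]; exact add_neg_cancel x
  exact (smul_eq_zero.mp h2).resolve_left two_ne_zero

lemma Th_sq (u : Fin d → ℂ) : Th u * Th u = 0 := self_zero (Th_anti u u)

def et (b : Matrix (Fin d) (Fin d) ℂ) (α : Fin d) : GA d := T α * Th (b α)

lemma et_sq (b : Matrix (Fin d) (Fin d) ℂ) (α : Fin d) : et b α * et b α = 0 := by
  rw [et, mul_assoc, ← mul_assoc (Th _), Th_T, neg_mul, mul_assoc, Th_sq, mul_zero, neg_zero,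
    mul_zero]

lemma et_eq (b : Matrix (Fin d) (Fin d) ℂ) (α : Fin d) :
    et b α = ∑ β, b α β • (G (Sum.inl α) * G (Sum.inr β)) := by
  simp only [et, Th_apply, mul_sum, mul_smul_comm]; rfl

lemma et_comm (b : Matrix (Fin d) (Fin d) ℂ) (α γ : Fin d) : Commute (et b α) (et b γ) := by
  rw [et_eq, et_eq]
  exact Commute.sum_left _ _ _ fun _ _ => Commute.smul_left (Commute.sum_right _ _ _ fun _ _ =>
    Commute.smul_right (G_comm _ _ _ _) _) _

lemma et_supp (b : Matrix (Fin d) (Fin d) ℂ) (α : Fin d) :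
    Supp (fun I J => I = {α} ∧ J.card = 1) (et b α) := by
  rw [et, Th_apply, mul_sum]
  refine Supp.sum fun β _ => ?_
  rw [mul_smul_comm]
  refine Supp.smul _ ?_
  simp only [T, Tb, GA.mul_def, mon_mul]
  simp only [disjoint_empty_left, disjoint_empty_right, and_self, if_true]
  exact Supp.smul _ (Supp.mon (by simp))

lemma et_nil (b : Matrix (Fin d) (Fin d) ℂ) (α : Fin d) : Nil (et b α) :=
  (et_supp b α).mono (by rintro I J ⟨rfl, h⟩; simp)

lemma exp_et (b : Matrix (Fin d) (Fin d) ℂ) (α : Fin d) :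
    IsNilpotent.exp (et b α) = 1 + et b α := by
  rw [IsNilpotent.exp_eq_sum (k := 2) (by rw [pow_two, et_sq])]
  simp [Finset.sum_range_succ]

lemma exp_list (b : Matrix (Fin d) (Fin d) ℂ) (l : List (Fin d)) :
    IsNilpotent.exp ((l.map (et b)).sum) = (l.map fun α => 1 + et b α).prod := by
  induction l with
  | nil => simp [IsNilpotent.exp_zero]
  | cons x l ih =>
    have hn : Nil ((l.map (et b)).sum) := by
      clear ih
      induction l with
      | nil => exact Supp.zero
      | cons y l ih => rw [List.map_cons, List.sum_cons]; exact (et_nil b y).add ih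
    have hc : Commute (et b x) ((l.map (et b)).sum) := by
      clear ih hn
      induction l with
      | nil => exact Commute.zero_right _
      | cons y l ih => rw [List.map_cons, List.sum_cons]; exact (et_comm b x y).add_right ih
    rw [List.map_cons, List.sum_cons, IsNilpotent.exp_add_of_commute hc (et_nil b x).isNilpotent
      hn.isNilpotent, ih, exp_et, List.map_cons, List.prod_cons]

lemma prod_supp (b : Matrix (Fin d) (Fin d) ℂ) (l : List (Fin d)) :
    Supp (fun I _ => I ⊆ l.toFinset) (l.map fun α => 1 + et b α).prod := by
  induction l with
  | nil => exact Supp.mon (by simp)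
  | cons x l ih =>
    rw [List.map_cons, List.prod_cons]
    have h1 : Supp (fun I _ => I ⊆ {x}) (1 + et b x) := by
      refine Supp.add (Supp.mon (by simp)) ((et_supp b x).mono ?_)
      rintro I J ⟨rfl, -⟩; rfl
    refine h1.mul ih fun I J K L _ _ h2 h3 => ?_
    rw [List.toFinset_cons, insert_eq]
    exact union_subset_union h2 h3

lemma prod_sub_supp (b : Matrix (Fin d) (Fin d) ℂ) (l : List (Fin d)) (hl : l.Nodup) :
    Supp (fun I _ => I ≠ l.toFinset)
      ((l.map fun α => 1 + et b α).prod - (l.map (et b)).prod) := by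
  induction l with
  | nil => simp only [List.map_nil, List.prod_nil, sub_self]; exact Supp.zero
  | cons x l ih =>
    rw [List.nodup_cons] at hl
    have hx : x ∉ l.toFinset := by simpa using hl.1
    have e : ((x :: l).map fun α => 1 + et b α).prod - ((x :: l).map (et b)).prod =
        (l.map fun α => 1 + et b α).prod
        + et b x * ((l.map fun α => 1 + et b α).prod - (l.map (et b)).prod) := by
      simp only [List.map_cons, List.prod_cons]; noncomm_ring
    rw [e, List.toFinset_cons]
    refine Supp.add ((prod_supp b l).mono ?_) ((et_supp b x).mul (ih hl.2) ?_)
    · rintro I J h rfl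
      exact hx (h (mem_insert_self _ _))
    · rintro I J K L h1 _ ⟨rfl, -⟩ h3 h4
      apply h3
      rw [disjoint_singleton_left] at h1
      rw [← insert_eq] at h4
      have := congrArg (fun s => s.erase x) h4
      simpa [erase_insert h1, erase_insert hx] using this

lemma Th_prodT (u : Fin d → ℂ) (l : List (Fin d)) :
    Th u * (l.map T).prod = (-1 : ℂ) ^ l.length • ((l.map T).prod * Th u) := by
  induction l with
  | nil => simp
  | cons x l ih =>
    rw [List.map_cons, List.prod_cons, ← mul_assoc, Th_T, neg_mul, mul_assoc, ih, List.length_cons,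
      pow_succ, mul_smul_comm, mul_assoc]
    simp

lemma prod_et (b : Matrix (Fin d) (Fin d) ℂ) (l : List (Fin d)) :
    (l.map (et b)).prod = (-1 : ℂ) ^ (l.length * (l.length - 1) / 2) •
      ((l.map T).prod * (l.map fun α => Th (b α)).prod) := by
  induction l with
  | nil => simp
  | cons x l ih =>
    have e : (x :: l).length * ((x :: l).length - 1) / 2
        = l.length * (l.length - 1) / 2 + l.length := by
      rw [List.length_cons, ← Finset.sum_range_id, ← Finset.sum_range_id, Finset.sum_range_succ]
    rw [e, List.map_cons, List.prod_cons, ih, List.map_cons, List.prod_cons, List.map_cons,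
      List.prod_cons, et, mul_smul_comm, mul_assoc, ← mul_assoc (Th _), Th_prodT, pow_add,
      smul_mul_assoc, mul_smul_comm, smul_smul]
    simp only [mul_assoc]

lemma prodT (l : List (Fin d)) (hl : l.Pairwise (· < ·)) :
    (l.map T).prod = mon l.toFinset ∅ := by
  induction l with
  | nil => simp [GA.one_def]
  | cons x l ih =>
    rw [List.pairwise_cons] at hl
    have h0 : x ∉ l := fun h => lt_irrefl _ (hl.1 x h)
    have h1 : l.toFinset.filter (fun k => k < x) = ∅ := by
      rw [filter_eq_empty_iff]; intro k hk; exact (hl.1 k (by simpa using hk)).not_gt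
    rw [List.map_cons, List.prod_cons, ih hl.2, T, GA.mul_def, mon_mul, if_pos (by simp [h0]),
      List.toFinset_cons, insert_eq, union_empty]
    simp [sg, rsign, h1]

lemma prodTb (l : List (Fin d)) (hl : l.Pairwise (· < ·)) :
    (l.map Tb).prod = mon ∅ l.toFinset := by
  induction l with
  | nil => simp [GA.one_def]
  | cons x l ih =>
    rw [List.pairwise_cons] at hl
    have h0 : x ∉ l := fun h => lt_irrefl _ (hl.1 x h)
    have h1 : l.toFinset.filter (fun k => k < x) = ∅ := by
      rw [filter_eq_empty_iff]; intro k hk; exact (hl.1 k (by simpa using hk)).not_gt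
    rw [List.map_cons, List.prod_cons, ih hl.2, Tb, GA.mul_def, mon_mul, if_pos (by simp [h0]),
      List.toFinset_cons, insert_eq, union_empty]
    simp [sg, rsign, h1]

lemma prodTh (b : Matrix (Fin d) (Fin d) ℂ) :
    (mon univ ∅ * ((List.finRange d).map fun α => Th (b α)).prod : GA d) univ univ = b.det := by
  let φ : ExteriorAlgebra ℂ (Fin d → ℂ) →ₐ[ℂ] GA d := ExteriorAlgebra.lift ℂ ⟨Th, Th_sq⟩
  let F : (Fin d → ℂ) [⋀^Fin d]→ₗ[ℂ] ℂ :=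
    ((coef univ univ ∘ₗ LinearMap.mulLeft ℂ (mon univ ∅ : GA d)) ∘ₗ
      φ.toLinearMap).compAlternatingMap (ExteriorAlgebra.ιMulti ℂ d)
  have hF : ∀ v : Fin d → Fin d → ℂ, F v =
      (mon univ ∅ * ((List.finRange d).map fun α => Th (v α)).prod : GA d) univ univ := by
    intro v
    show (mon univ ∅ * φ (ExteriorAlgebra.ιMulti ℂ d v) : GA d) univ univ = _
    rw [ExteriorAlgebra.ιMulti_apply, map_list_prod, List.ofFn_eq_map, List.map_map]
    have : (⇑φ ∘ fun i => (ExteriorAlgebra.ι ℂ) (v i)) = fun α => Th (v α) := by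
      funext α
      simp [φ]
    rw [this]
  have h1 : F (Pi.basisFun ℂ (Fin d)) = 1 := by
    rw [hF]
    have : (fun α => Th (Pi.basisFun ℂ (Fin d) α)) = (Tb : Fin d → GA d) := by
      funext α
      simp [Th, Fintype.linearCombination_apply_single]
    rw [this, prodTb _ (List.pairwise_lt_finRange d), GA.mul_def, mon_mul]
    simp [sg, rsign, GA.smul_apply, mon]
  have h2 := F.eq_smul_basis_det (Pi.basisFun ℂ (Fin d))
  rw [h1, one_smul, Pi.basisFun_det] at h2
  refine (hF b).symm.trans ?_
  rw [h2]
  rfl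

lemma exp_B_top (b : Matrix (Fin d) (Fin d) ℂ) :
    (IsNilpotent.exp (qd b Sum.inl Sum.inr) : GA d) univ univ
      = (-1 : ℂ) ^ (d * (d - 1) / 2) * b.det := by
  have e : qd b Sum.inl Sum.inr = ((List.finRange d).map (et b)).sum := by
    rw [qd, ← List.ofFn_eq_map, List.sum_ofFn]
    exact sum_congr rfl fun α _ => (et_eq b α).symm
  rw [e, exp_list]
  have h := prod_sub_supp b (List.finRange d) (List.nodup_finRange d) univ univ
  have h1 : (((List.finRange d).map fun α => 1 + et b α).prod
      - ((List.finRange d).map (et b)).prod : GA d) univ univ = 0 := by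
    by_contra h2
    exact h h2 (by simp)
  have h3 := sub_eq_zero.mp h1
  rw [h3, prod_et, GA.smul_apply, prodT _ (List.pairwise_lt_finRange d)]
  simp only [List.toFinset_finRange, List.length_finRange]
  rw [prodTh]

lemma top_right {f g : GA d} (hf : Supp (fun I J => I.card = J.card) f)
    (hg : Supp (fun I _ => I = ∅) g) (J : Ix d) :
    (f * g) univ J = if J = univ then f univ univ * g ∅ ∅ else 0 := by
  split_ifs with h
  · subst h
    rw [GA.mul_def, gmulL_apply, Finset.sum_eq_single univ, Finset.sum_eq_single univ]
    · simp [sg_empty_right]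
    · intro J _ hJ
      by_cases h0 : f univ J = 0
      · simp [h0]
      · have h1 := hf _ _ h0
        exact absurd ((card_eq_iff_eq_univ J).mp (h1.symm.trans (card_univ))) hJ
    · simp
    · intro I _ hI
      apply Finset.sum_eq_zero
      intro J _
      by_cases h0 : g (univ \ I) (univ \ J) = 0
      · simp [h0]
      · have h1 := hg _ _ h0
        exact absurd (univ_subset_iff.mp (sdiff_eq_empty_iff_subset.mp h1)) hI
    · simp
  · by_contra h0
    have h1 : Supp (fun I J => I = univ → J = univ) (f * g) := by
      refine hf.mul hg ?_
      rintro I J K L _ _ h2 rfl h3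
      rw [union_empty] at h3
      subst h3
      have : J = univ := (card_eq_iff_eq_univ J).mp (h2.symm.trans (card_univ))
      rw [this]; exact univ_subset_iff.mp subset_union_left
    exact h (h1 _ _ h0 rfl)

lemma top_left {f : GA d} (hf : Supp (fun _ J => J = ∅) f) (g : GA d) (J : Ix d) :
    (f * g) univ J = ∑ I, (sg Iᶜ ∅ I ∅ * f Iᶜ ∅) * g I J := by
  rw [GA.mul_def, gmulL_apply, powerset_univ]
  refine Finset.sum_bij' (fun I _ => Iᶜ) (fun I _ => Iᶜ) (by simp) (by simp) (by simp) (by simp) ?_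
  intro I _
  rw [Finset.sum_eq_single ∅]
  · rw [compl_compl, ← compl_eq_univ_sdiff, sdiff_empty, ← mul_assoc]
    simp [sg, rsign]
  · intro K _ hK
    by_cases h0 : f I K = 0
    · simp [h0]
    · exact absurd (hf _ _ h0) hK
  · simp

lemma GG_supp (x y : Fin d ⊕ Fin d) (p : Ix d → Ix d → Prop)
    (h : p ((x.elim (fun i => {i}) fun _ => ∅) ∪ (y.elim (fun i => {i}) fun _ => ∅))
      ((x.elim (fun _ => ∅) fun i => {i}) ∪ (y.elim (fun _ => ∅) fun i => {i}))) :
    Supp p (G x * G y) := by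
  have hG : ∀ z : Fin d ⊕ Fin d, (G z : GA d) = mon (z.elim (fun i => {i}) fun _ => ∅)
      (z.elim (fun _ => ∅) fun i => {i}) := by
    rintro (z | z) <;> rfl
  rw [hG, hG, GA.mul_def, mon_mul]
  split_ifs
  · exact Supp.smul _ (Supp.mon h)
  · exact Supp.zero

lemma qd_supp (m : Matrix (Fin d) (Fin d) ℂ) (f g : Fin d → Fin d ⊕ Fin d)
    {p : Ix d → Ix d → Prop} (h : ∀ α γ, Supp p (G (f α) * G (g γ))) : Supp p (qd m f g) :=
  Supp.sum fun _ _ => Supp.sum fun _ _ => Supp.smul _ (h _ _)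

end MyProof

/-- With `Z` as in Statement 0 (`b` invertible), write
`e^Z = w_{IJ}θ^Iθ̄^J`, and let `(t^{JI})` be the inverse of the `2^d × 2^d` matrix
`(w_{IJ})`, i.e. `t^{LK}w_{KJ} = δ^L_J` and `w_{IK}t^{KJ} = δ_I^J`. Then
`t^{[d][d]} = (−1)^{d(d−1)/2} (det b)⁻¹`. -/
theorem statement1 {d : ℕ} (hd : 1 ≤ d) (a b c : Matrix (Fin d) (Fin d) ℂ)
    (hb : IsUnit b)
    (w : Ix d → Ix d → ℂ) (hw : ∀ I J, w I J = gexp (quadZ a b c) I J)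
    (t : Matrix (Ix d) (Ix d) ℂ)
    (ht1 : t * (Matrix.of fun I J : Ix d => w I J) = 1)
    (ht2 : (Matrix.of fun I J : Ix d => w I J) * t = 1) :
    t Finset.univ Finset.univ = (-1 : ℂ) ^ (d * (d - 1) / 2) * (b.det)⁻¹ := by
  set A : GA d := (1 / 2 : ℂ) • qd a Sum.inl Sum.inl with hA
  set B : GA d := qd b Sum.inl Sum.inr with hB
  set C : GA d := (1 / 2 : ℂ) • qd c Sum.inr Sum.inr with hC
  have nA : Nil A := Supp.smul _ (qd_nil _ _ _)
  have nB : Nil B := qd_nil _ _ _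
  have nC : Nil C := Supp.smul _ (qd_nil _ _ _)
  have cAB : Commute A B := (qd_comm _ _ _ _ _ _).smul_left _
  have cAC : Commute A C := ((qd_comm _ _ _ _ _ _).smul_left _).smul_right _
  have cBC : Commute B C := (qd_comm _ _ _ _ _ _).smul_right _
  have sA : Supp (fun _ J => J = ∅) A :=
    Supp.smul _ (qd_supp _ _ _ fun _ _ => GG_supp _ _ _ (by simp))
  have sB : Supp (fun I J => I.card = J.card) B :=
    qd_supp _ _ _ fun _ _ => GG_supp _ _ _ (by simp)
  have sC : Supp (fun I _ => I = ∅) C :=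
    Supp.smul _ (qd_supp _ _ _ fun _ _ => GG_supp _ _ _ (by simp))
  have hneg : (-A : GA d) = (-1 : ℂ) • A := by simp
  have nA' : Nil (-A) := by rw [hneg]; exact Supp.smul _ nA
  have sA' : Supp (fun _ J => J = ∅) (-A) := by rw [hneg]; exact Supp.smul _ sA
  have hwZ : ∀ I J, w I J = (IsNilpotent.exp (A + B + C) : GA d) I J := by
    intro I J
    rw [hw, quadZ_eq]
    exact congrFun (congrFun (Nil.gexp_eq ((nA.add nB).add nC)) I) J
  have hprod : IsNilpotent.exp (-A) * IsNilpotent.exp (A + B + C)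
      = IsNilpotent.exp B * IsNilpotent.exp C := by
    rw [add_assoc, IsNilpotent.exp_add_of_commute (cAB.add_right cAC) nA.isNilpotent
      (Nil.isNilpotent (nB.add nC)), ← mul_assoc, IsNilpotent.exp_neg_mul_exp_self nA.isNilpotent,
      one_mul, IsNilpotent.exp_add_of_commute cBC nB.isNilpotent nC.isNilpotent]
  have sEA : Supp (fun _ J => J = ∅) (IsNilpotent.exp (-A)) :=
    sA'.exp nA' rfl (by rintro I J K L - - rfl rfl; simp)
  have sEB : Supp (fun I J => I.card = J.card) (IsNilpotent.exp B) :=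
    sB.exp nB rfl (by
      intro I J K L h1 h2 h3 h4
      rw [Finset.card_union_of_disjoint h1, Finset.card_union_of_disjoint h2, h3, h4])
  have sEC : Supp (fun I _ => I = ∅) (IsNilpotent.exp C) :=
    sC.exp nC rfl (by rintro I J K L - - rfl rfl; simp)
  set s : ℂ := (-1 : ℂ) ^ (d * (d - 1) / 2) with hs
  let y : Ix d → ℂ := fun I => sg Iᶜ ∅ I ∅ * (IsNilpotent.exp (-A) : GA d) Iᶜ ∅
  have hy : y Finset.univ = 1 := by
    simp only [y, Finset.compl_univ, exp_empty nA']
    simp [sg, rsign]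
  have hyW : Matrix.vecMul y (Matrix.of fun I J : Ix d => w I J)
      = Pi.single Finset.univ (s * b.det) := by
    funext J
    have h := top_left sEA (IsNilpotent.exp (A + B + C)) J
    rw [hprod, top_right sEB sEC, exp_B_top, exp_empty nC, mul_one] at h
    rw [Pi.single_apply, h]
    simp only [Matrix.vecMul, dotProduct, Matrix.of_apply, hwZ, y]
  have hfin : y = Matrix.vecMul (Pi.single Finset.univ (s * b.det)) t := by
    rw [← hyW, Matrix.vecMul_vecMul, ht2, Matrix.vecMul_one]
  have h1 := congrFun hfin Finset.univ
  rw [hy, Matrix.single_vecMul] at h1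
  have hdet : b.det ≠ 0 := ((Matrix.isUnit_iff_isUnit_det b).mp hb).ne_zero
  have hss : s * s = 1 := by
    rw [hs, ← mul_pow]; simp
  have h1' : 1 = s * b.det * t Finset.univ Finset.univ := by simpa using h1
  rw [eq_mul_inv_iff_mul_eq₀ hdet]
  linear_combination (-s) * h1' - t Finset.univ Finset.univ * b.det * hss

end Grass
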